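/- arXiv:0805.2235 — 2 statements merged into one kernel-verified Lean document; each statement's English description precedes it below -/
import Mathlib

section
/- Little Picard Theorem: every entire function f : ℂ → ℂ which omits two distinct complex values is constant. -/
open Complex Metric Set Filter Topology in
theorem lp_ball_subset (g : ℂ → ℂ) (hg : Differentiable ℂ g) (p : ℂ) (t : ℝ) (ht : 0 < t)
    (hp : deriv g p ≠ 0) (hb : ∀ z ∈ ball p t, ‖deriv g z‖ ≤ 2 * ‖deriv g p‖) :
    ball (g p) (‖deriv g p‖ * t / 12 / 2) ⊆ range g := by
  have hg' : Differentiable ℂ (deriv g) := hg.deriv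
  have hpos : 0 < ‖deriv g p‖ := norm_pos_iff.2 hp
  have hsch : ∀ z ∈ closedBall p (t / 6), ‖deriv g z - deriv g p‖ ≤ ‖deriv g p‖ / 2 := by
    intro z hz
    have hz1 : dist z p ≤ t / 6 := hz
    have hz2 : z ∈ ball p t := by rw [mem_ball]; linarith
    have hm : MapsTo (deriv g) (ball p t) (closedBall (deriv g p) (3 * ‖deriv g p‖)) := by
      intro w hw
      rw [mem_closedBall, dist_eq_norm]
      have := norm_sub_le (deriv g w) (deriv g p)
      have := hb w hw
      linarith
    have h := Complex.dist_le_div_mul_dist_of_mapsTo_ball hg'.differentiableOn hm hz2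
    rw [dist_eq_norm] at h
    refine h.trans ?_
    calc 3 * ‖deriv g p‖ / t * dist z p ≤ 3 * ‖deriv g p‖ / t * (t / 6) := by gcongr
      _ = ‖deriv g p‖ / 2 := by field_simp; norm_num
  have hmv : ∀ z ∈ closedBall p (t / 6),
      ‖(g z - deriv g p * z) - (g p - deriv g p * p)‖ ≤ ‖deriv g p‖ / 2 * ‖z - p‖ := by
    intro z hz
    refine (convex_closedBall p (t/6)).norm_image_sub_le_of_norm_hasDerivWithin_le
      (f := fun z => g z - deriv g p * z) (f' := fun z => deriv g z - deriv g p)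
      (fun x _ => ?_) hsch (mem_closedBall_self (by positivity)) hz
    have h1 := (hg x).hasDerivAt.sub ((hasDerivAt_id x).const_mul (deriv g p))
    rw [mul_one] at h1
    exact h1.hasDerivWithinAt
  have hmain := DiffContOnCl.ball_subset_image_closedBall (f := g) (z₀ := p) (r := t / 6)
    (ε := ‖deriv g p‖ * t / 12) hg.diffContOnCl (by positivity) ?_ ?_
  · exact hmain.trans (image_subset_range _ _)
  · intro z hz
    have hz1 : ‖z - p‖ = t / 6 := by simpa [dist_eq_norm] using hz
    have h1 := hmv z (sphere_subset_closedBall hz)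
    have h2 : ‖deriv g p * (z - p)‖ ≤ ‖g z - g p‖ + ‖(g z - deriv g p * z) - (g p - deriv g p * p)‖ := by
      have := norm_sub_le (g z - g p) ((g z - deriv g p * z) - (g p - deriv g p * p))
      refine le_trans (le_of_eq ?_) this
      congr 1; ring
    rw [norm_mul, hz1] at h2
    rw [hz1] at h1
    linarith
  · intro h
    have h' : g =ᶠ[𝓝 p] fun _ => g p := by
      filter_upwards [h] with z hz
      simpa using hz
    exact hp (by rw [h'.deriv_eq]; simp)

open Complex Metric Set Filter Topology in
theorem lp_bloch (g : ℂ → ℂ) (hg : Differentiable ℂ g) (a : ℂ) (ha : deriv g a ≠ 0) (C : ℝ) :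
    ∃ w, ball w C ⊆ range g := by
  have hpos : 0 < ‖deriv g a‖ := norm_pos_iff.2 ha
  set R : ℝ := 48 * (|C| + 1) / ‖deriv g a‖ with hR
  have hRpos : 0 < R := by positivity
  have hcont : Continuous fun z => (R - dist z a) * ‖deriv g z‖ := by
    have := hg.deriv.continuous
    fun_prop
  obtain ⟨p, hp, hmax⟩ := (isCompact_closedBall a R).exists_isMaxOn
    ⟨a, mem_closedBall_self hRpos.le⟩ hcont.continuousOn
  have hM : R * ‖deriv g a‖ ≤ (R - dist p a) * ‖deriv g p‖ := by
    simpa using hmax (mem_closedBall_self hRpos.le)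
  have hp' : dist p a ≤ R := hp
  have hprod : 0 < (R - dist p a) * ‖deriv g p‖ := lt_of_lt_of_le (by positivity) hM
  have ht : 0 < R - dist p a := by
    rcases (sub_nonneg.2 hp').eq_or_lt with h | h
    · rw [← h] at hprod; simp at hprod
    · exact h
  have hd : deriv g p ≠ 0 := by
    intro h; rw [h] at hprod; simp at hprod
  refine ⟨g p, Subset.trans (ball_subset_ball ?_)
    (lp_ball_subset g hg p ((R - dist p a) / 2) (by positivity) hd ?_)⟩
  · have h1 : R * ‖deriv g a‖ = 48 * (|C| + 1) := by rw [hR]; field_simp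
    have := le_abs_self C
    linarith
  · intro z hz
    have hz1 : dist z p < (R - dist p a) / 2 := hz
    have h2 : dist z a ≤ dist z p + dist p a := dist_triangle _ _ _
    have h3 : (R - dist z a) * ‖deriv g z‖ ≤ (R - dist p a) * ‖deriv g p‖ :=
      hmax (show z ∈ closedBall a R by rw [mem_closedBall]; linarith)
    have h4 : (R - dist p a) / 2 * ‖deriv g z‖ ≤ (R - dist z a) * ‖deriv g z‖ := by
      gcongr; linarith
    have h5 : (R - dist p a) * ‖deriv g z‖ ≤ (R - dist p a) * (2 * ‖deriv g p‖) := by linarith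
    exact le_of_mul_le_mul_left h5 ht

theorem lp_exp_lift (f : ℂ → ℂ) (hf : Differentiable ℂ f) (h0 : ∀ z, f z ≠ 0) :
    ∃ g : ℂ → ℂ, Differentiable ℂ g ∧ ∀ z, f z = Complex.exp (g z) := by
  have hq : Differentiable ℂ (fun z => deriv f z / f z) := hf.deriv.div hf h0
  obtain ⟨G, hG0, hG⟩ := hq.isExactOn_univ.with_val_at 0 (Complex.log (f 0))
  have hG' : ∀ z, HasDerivAt G (deriv f z / f z) z := fun z => hG z (Set.mem_univ z)
  have hGd : Differentiable ℂ G := fun z => (hG' z).differentiableAt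
  refine ⟨G, hGd, fun z => ?_⟩
  have hD : ∀ z, HasDerivAt (fun z => f z * Complex.exp (-G z)) 0 z := by
    intro z
    have hm := (hf z).hasDerivAt.mul (hG' z).neg.cexp
    have hz := h0 z
    have e : deriv f z * Complex.exp ((-G) z)
        + f z * (Complex.exp ((-G) z) * -(deriv f z / f z)) = 0 := by
      field_simp
      ring
    rw [e] at hm
    exact hm
  have hc := is_const_of_deriv_eq_zero (fun z => (hD z).differentiableAt)
    (fun z => (hD z).deriv) z 0
  simp only [hG0, Complex.exp_neg, Complex.exp_log (h0 0), mul_inv_cancel₀ (h0 0)] at hc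
  have := Complex.exp_ne_zero (G z)
  field_simp at hc
  exact hc

theorem lp_cos_lift (f : ℂ → ℂ) (hf : Differentiable ℂ f) (h1 : ∀ z, f z ≠ 1)
    (h2 : ∀ z, f z ≠ -1) :
    ∃ F : ℂ → ℂ, Differentiable ℂ F ∧ ∀ z, f z = Complex.cos (Real.pi * F z) := by
  obtain ⟨G, hG, hGe⟩ := lp_exp_lift (fun z => f z ^ 2 - 1) (by fun_prop) (fun z h => by
    have : (f z - 1) * (f z + 1) = 0 := by linear_combination h
    rcases mul_eq_zero.1 this with h | h
    · exact h1 z (sub_eq_zero.1 h)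
    · exact h2 z (eq_neg_of_add_eq_zero_left h))
  have hs : ∀ z, (f z + Complex.exp (G z / 2)) * (f z - Complex.exp (G z / 2)) = 1 := by
    intro z
    have h3 : Complex.exp (G z / 2) * Complex.exp (G z / 2) = Complex.exp (G z) := by
      rw [← Complex.exp_add]; ring_nf
    have h4 := hGe z
    linear_combination h4 - h3
  obtain ⟨H, hH, hHe⟩ := lp_exp_lift (fun z => f z + Complex.exp (G z / 2)) (by fun_prop)
    (fun z h => by have := hs z; rw [h] at this; simp at this)
  refine ⟨fun z => H z / (Complex.I * Real.pi), by fun_prop, fun z => ?_⟩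
  have hpi : (Real.pi : ℂ) ≠ 0 := by exact_mod_cast Real.pi_ne_zero
  have e1 : (Real.pi : ℂ) * (H z / (Complex.I * Real.pi)) * Complex.I = H z := by
    field_simp
  have h5 := hHe z
  have h6 : f z - Complex.exp (G z / 2) = Complex.exp (-H z) := by
    rw [Complex.exp_neg, ← h5]
    exact eq_inv_of_mul_eq_one_right (hs z)
  rw [Complex.cos, neg_mul, e1, ← h5, ← h6]
  ring

theorem lp_cosh_grid (v : ℝ) (hv : 0 ≤ v) :
    ∃ y ∈ Set.Icc v (v + 1), ∃ n : ℕ, Real.cosh (Real.pi * y) = n := by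
  have hpi := Real.pi_gt_three
  have hc2 : 2 ≤ Real.cosh Real.pi := by
    have h1 := Real.add_one_le_exp Real.pi
    have h2 := Real.exp_pos (-Real.pi)
    rw [Real.cosh_eq]; linarith
  have hb : Real.cosh (Real.pi * v) + 1 ≤ Real.cosh (Real.pi * (v + 1)) := by
    have h1 := Real.one_le_cosh (Real.pi * v)
    have h2 : 0 ≤ Real.sinh (Real.pi * v) := Real.sinh_nonneg_iff.2 (by positivity)
    have h3 : 0 ≤ Real.sinh Real.pi := Real.sinh_nonneg_iff.2 (by positivity)
    rw [mul_add, mul_one, Real.cosh_add]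
    nlinarith [mul_nonneg h2 h3]
  have hcont : ContinuousOn (fun y => Real.cosh (Real.pi * y)) (Set.Icc v (v + 1)) :=
    (Real.continuous_cosh.comp (continuous_const.mul continuous_id)).continuousOn
  have hpos : 0 ≤ Real.cosh (Real.pi * v) := (Real.cosh_pos _).le
  obtain ⟨y, hy, hye⟩ := intermediate_value_Icc (by linarith : v ≤ v + 1) hcont
    (show (⌈Real.cosh (Real.pi * v)⌉₊ : ℝ) ∈ _ from
      ⟨Nat.le_ceil _, ((Nat.ceil_lt_add_one hpos).le).trans hb⟩)
  exact ⟨y, hy, _, hye⟩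

theorem lp_cos_int (k : ℤ) : Complex.cos (k * Real.pi) = (-1) ^ k := by
  have h := Real.cos_int_mul_pi k
  have h' : ((Real.cos (k * Real.pi) : ℝ) : ℂ) = (((-1) ^ k : ℝ) : ℂ) := by rw [h]
  push_cast at h'
  exact h'

theorem lp_cos_grid (w : ℂ) :
    ∃ u ∈ Metric.ball w 3, ∃ k : ℤ, Complex.cos (Real.pi * u) = k := by
  obtain ⟨y, hy, n, hn⟩ := lp_cosh_grid |w.im| (abs_nonneg _)
  obtain ⟨y', hy', hn'⟩ : ∃ y' : ℝ, |y' - w.im| ≤ 1 ∧ Real.cosh (Real.pi * y') = n := by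
    rcases le_total 0 w.im with h | h
    · rw [abs_of_nonneg h] at hy
      exact ⟨y, by rw [abs_le]; constructor <;> linarith [hy.1, hy.2], hn⟩
    · rw [abs_of_nonpos h] at hy
      exact ⟨-y, by rw [abs_le]; constructor <;> linarith [hy.1, hy.2],
        by rw [mul_neg, Real.cosh_neg, hn]⟩
  refine ⟨⟨(⌊w.re⌋ : ℝ), y'⟩, ?_, ?_⟩
  · rw [mem_ball_iff_norm]
    refine lt_of_le_of_lt (Complex.norm_le_abs_re_add_abs_im _) ?_
    have h1 : |(⌊w.re⌋ : ℝ) - w.re| ≤ 1 := by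
      rw [abs_le]; constructor <;> linarith [Int.floor_le w.re, Int.lt_floor_add_one w.re]
    simp only [Complex.sub_re, Complex.sub_im]
    linarith
  · have e : (Real.pi : ℂ) * (⟨(⌊w.re⌋ : ℝ), y'⟩ : ℂ)
        = ((⌊w.re⌋ : ℤ) : ℂ) * Real.pi + ((Real.pi * y' : ℝ) : ℂ) * Complex.I := by
      rw [Complex.mk_eq_add_mul_I]; push_cast; ring
    rw [e, Complex.cos_add, Complex.sin_int_mul_pi, Complex.cos_mul_I, ← Complex.ofReal_cosh, hn',
      lp_cos_int]
    rcases Int.even_or_odd ⌊w.re⌋ with he | ho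
    · exact ⟨n, by rw [he.neg_one_zpow]; push_cast; ring⟩
    · exact ⟨-n, by rw [ho.neg_one_zpow]; push_cast; ring⟩

theorem lp_main (f : ℂ → ℂ) (hf : Differentiable ℂ f) (h1 : ∀ z, f z ≠ 1)
    (h2 : ∀ z, f z ≠ -1) : ∃ c, ∀ z, f z = c := by
  obtain ⟨F, hF, hFe⟩ := lp_cos_lift f hf h1 h2
  have hFint : ∀ z, ∀ k : ℤ, F z ≠ k := by
    intro z k hk
    have h := hFe z
    rw [hk, mul_comm, lp_cos_int] at h
    rcases Int.even_or_odd k with he | ho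
    · exact h1 z (by rw [h, he.neg_one_zpow])
    · exact h2 z (by rw [h, ho.neg_one_zpow])
  obtain ⟨g, hg, hge⟩ := lp_cos_lift F hF (fun z => by simpa using hFint z 1)
    (fun z => by simpa using hFint z (-1))
  have hd : ∀ z, deriv g z = 0 := by
    intro a
    by_contra ha
    obtain ⟨w, hw⟩ := lp_bloch g hg a ha 3
    obtain ⟨u, hu, k, hk⟩ := lp_cos_grid w
    obtain ⟨z, rfl⟩ := hw hu
    exact hFint z k (by rw [hge z, hk])
  refine ⟨f 0, fun z => ?_⟩
  rw [hFe z, hFe 0, hge z, hge 0, is_const_of_deriv_eq_zero hg hd z 0]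

/-- Little Picard Theorem: an entire function omitting two distinct complex
values is constant. -/
theorem little_picard (f : ℂ → ℂ) (hf : Differentiable ℂ f) (a b : ℂ)
    (hab : a ≠ b) (ha : ∀ z, f z ≠ a) (hb : ∀ z, f z ≠ b) :
    ∃ c : ℂ, ∀ z, f z = c := by
  have hne : b - a ≠ 0 := sub_ne_zero.2 hab.symm
  obtain ⟨c, hc⟩ := lp_main (fun z => 2 * (f z - a) / (b - a) - 1) (by fun_prop)
    (fun z h => hb z (by
      field_simp at h
      linear_combination (1 / 2) * h))
    (fun z h => ha z (by
      field_simp at h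
      linear_combination (1 / 2) * h))
  refine ⟨(c + 1) * (b - a) / 2 + a, fun z => ?_⟩
  rw [← hc z]
  field_simp
  ring
end

section
/- Big Picard Theorem: if a holomorphic function f on the punctured disk 𝔻' = {z : 0 < |z| < 1} has an essential singularity at z = 0, then there is at most one complex number a for which the equation f(z) = a has no solution in 𝔻'. -/
open Metric Set Filter Topology

lemma bp_local {h : ℂ → ℂ} {a : ℂ} {t : ℝ} (ht : 0 < t)
    (hd : DifferentiableOn ℂ h (ball a t)) (h0 : deriv h a ≠ 0)
    (hb : ∀ z ∈ ball a t, ‖deriv h z‖ ≤ 2 * ‖deriv h a‖) :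
    ball (h a) (‖deriv h a‖ * t / 32) ⊆ h '' ball a t := by
  have hA : 0 < ‖deriv h a‖ := norm_pos_iff.2 h0
  have hd' : DifferentiableOn ℂ (deriv h) (ball a t) := hd.deriv isOpen_ball
  have hm : MapsTo (deriv h) (ball a t) (closedBall (deriv h a) (3 * ‖deriv h a‖)) := by
    intro z hz
    rw [mem_closedBall, dist_eq_norm]
    have := norm_sub_le (deriv h z) (deriv h a)
    have := hb z hz
    linarith
  have hsub : closedBall a (t/8) ⊆ ball a t := closedBall_subset_ball (by linarith)
  have hder : ∀ z ∈ closedBall a (t/8), ‖deriv h z - deriv h a‖ ≤ ‖deriv h a‖ / 2 := by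
    intro z hz
    have h1 := Complex.dist_le_div_mul_dist_of_mapsTo_ball hd' hm (hsub hz)
    rw [dist_eq_norm] at h1
    rw [mem_closedBall] at hz
    have : 3 * ‖deriv h a‖ / t * dist z a ≤ 3 * ‖deriv h a‖ / t * (t / 8) := by gcongr
    have e : 3 * ‖deriv h a‖ / t * (t / 8) = 3 * ‖deriv h a‖ / 8 := by field_simp
    linarith
  have hda : ∀ z ∈ ball a t, HasDerivAt h (deriv h z) z := fun z hz =>
    (hd.differentiableAt (isOpen_ball.mem_nhds hz)).hasDerivAt
  have key : ∀ z ∈ closedBall a (t/8),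
      ‖(h z - deriv h a * z) - (h a - deriv h a * a)‖ ≤ ‖deriv h a‖ / 2 * ‖z - a‖ := by
    intro z hz
    refine (convex_closedBall a (t/8)).norm_image_sub_le_of_norm_hasDerivWithin_le
      (f := fun z => h z - deriv h a * z) (f' := fun z => deriv h z - deriv h a)
      (fun w hw => ?_) hder (mem_closedBall_self (by linarith)) hz
    have := (hda w (hsub hw)).sub ((hasDerivAt_id w).const_mul (deriv h a))
    rw [mul_one] at this
    exact this.hasDerivWithinAt
  have low : ∀ z ∈ closedBall a (t/8), ‖deriv h a‖ / 2 * ‖z - a‖ ≤ ‖h z - h a‖ := by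
    intro z hz
    have h1 := key z hz
    have h2 : deriv h a * (z - a) = (h z - h a) -
      ((h z - deriv h a * z) - (h a - deriv h a * a)) := by ring
    have h3 := norm_sub_le (h z - h a) ((h z - deriv h a * z) - (h a - deriv h a * a))
    rw [← h2, norm_mul] at h3
    linarith
  have hdc : DiffContOnCl ℂ h (ball a (t/8)) := by
    refine DifferentiableOn.diffContOnCl ?_
    exact hd.mono (closure_ball_subset_closedBall.trans hsub)
  have := hdc.ball_subset_image_closedBall (by linarith) (ε := ‖deriv h a‖ * t / 16)
    (fun z hz => by
      have h1 := low z (sphere_subset_closedBall hz)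
      rw [mem_sphere, dist_eq_norm] at hz
      rw [hz] at h1
      linarith) (by
      have h1 := (hda a (mem_ball_self ht)).eventually_ne (c := h a) h0
      exact (h1.frequently).filter_mono nhdsWithin_le_nhds)
  rw [show ‖deriv h a‖ * t / 32 = ‖deriv h a‖ * t / 16 / 2 by ring]
  exact this.trans (image_mono hsub)

lemma bp_bloch {h : ℂ → ℂ} {c : ℂ} {R : ℝ} (hR : 0 < R)
    (hd : DifferentiableOn ℂ h (ball c R))
    (ho : ∀ p : ℂ, ∃ q ∈ ball p 4, q ∉ h '' ball c R) :
    ‖deriv h c‖ * R ≤ 512 := by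
  by_cases h0 : deriv h c = 0
  · simp [h0]
  have hc0 : 0 < ‖deriv h c‖ := norm_pos_iff.2 h0
  have hsub : closedBall c (R/2) ⊆ ball c R := closedBall_subset_ball (by linarith)
  have hd' : ContinuousOn (deriv h) (ball c R) := (hd.deriv isOpen_ball).continuousOn
  obtain ⟨a, ha, hmax⟩ := (isCompact_closedBall c (R/2)).exists_isMaxOn
    (f := fun z => ‖deriv h z‖ * (R/2 - dist z c))
    ⟨c, mem_closedBall_self (by linarith)⟩
    ((hd'.mono hsub).norm.mul (by fun_prop))
  have hcm := hmax (mem_closedBall_self (x := c) (ε := R/2) (by linarith))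
  simp only [mem_ofPred_eq, dist_self, sub_zero] at hcm
  have ha' := mem_closedBall.1 ha
  set t := (R/2 - dist a c)/2 with htdef
  have ht : 0 < t := by
    have : 0 < ‖deriv h a‖ * (R/2 - dist a c) := lt_of_lt_of_le (by positivity) hcm
    have := pos_of_mul_pos_right this (norm_nonneg _)
    rw [htdef]; linarith
  have ha0 : deriv h a ≠ 0 := by
    intro e
    rw [e] at hcm
    simp at hcm
    have := mul_pos hc0 (half_pos hR)
    linarith
  have hbs : ball a t ⊆ closedBall c (R/2) := by
    intro z hz
    rw [mem_ball] at hz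
    rw [mem_closedBall]
    have := dist_triangle z a c
    linarith
  have hloc := bp_local ht (hd.mono (hbs.trans hsub)) ha0 (by
    intro z hz
    have h1 := hmax (hbs hz)
    simp only [mem_ofPred_eq] at h1
    rw [mem_ball] at hz
    have h2 := dist_triangle z a c
    have h3 : ‖deriv h z‖ * t ≤ ‖deriv h z‖ * (R/2 - dist z c) := by
      gcongr; linarith
    have h4 : R/2 - dist a c = 2 * t := by rw [htdef]; ring
    rw [h4] at h1
    have : ‖deriv h z‖ * t ≤ (2 * ‖deriv h a‖) * t := by linarith
    exact le_of_mul_le_mul_right this ht)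
  obtain ⟨q, hq, hqn⟩ := ho (h a)
  by_contra hcon
  push Not at hcon
  apply hqn
  apply image_mono (hbs.trans hsub)
  apply hloc
  apply ball_subset_ball _ hq
  have h4 : R/2 - dist a c = 2 * t := by rw [htdef]; ring
  rw [h4] at hcm
  linarith

lemma bp_log {f : ℂ → ℂ} {c : ℂ} {R : ℝ} (hR : 0 < R)
    (hd : DifferentiableOn ℂ f (ball c R)) (h0 : ∀ z ∈ ball c R, f z ≠ 0) :
    ∃ g : ℂ → ℂ, DifferentiableOn ℂ g (ball c R) ∧ ∀ z ∈ ball c R, Complex.exp (g z) = f z := by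
  have hq : DifferentiableOn ℂ (fun z => deriv f z / f z) (ball c R) :=
    (hd.deriv isOpen_ball).div hd h0
  obtain ⟨G, hG⟩ := hq.isExactOn_ball
  have hda : ∀ z ∈ ball c R, HasDerivAt f (deriv f z) z := fun z hz =>
    (hd.differentiableAt (isOpen_ball.mem_nhds hz)).hasDerivAt
  have hk : ∀ z ∈ ball c R, HasDerivAt (fun z => f z * Complex.exp (- G z)) 0 z := by
    intro z hz
    have h1 := (hda z hz).mul (hG z hz).neg.cexp
    have h2 := h0 z hz
    refine h1.congr_deriv ?_
    change deriv f z * Complex.exp (-G z) + f z * (Complex.exp (-G z) * -(deriv f z / f z)) = 0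
    field_simp
    ring
  have hcb : c ∈ ball c R := mem_ball_self hR
  have hconst : ∀ z ∈ ball c R, f z * Complex.exp (- G z) = f c * Complex.exp (- G c) := by
    intro z hz
    have := (convex_ball c R).norm_image_sub_le_of_norm_hasDerivWithin_le (C := 0)
      (fun w hw => (hk w hw).hasDerivWithinAt) (by simp) hcb hz
    simpa [sub_eq_zero] using this
  refine ⟨fun z => G z + Complex.log (f c * Complex.exp (- G c)), fun z hz =>
    ((hG z hz).differentiableAt.add_const _).differentiableWithinAt, fun z hz => ?_⟩
  rw [Complex.exp_add, Complex.exp_log (mul_ne_zero (h0 c hcb) (Complex.exp_ne_zero _)),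
    ← hconst z hz, Complex.exp_neg]
  have := Complex.exp_ne_zero (G z)
  field_simp

lemma bp_abs_im (z : ℂ) : |z.im| ≤ ‖Complex.cos z‖ := by
  have h1 : ‖Complex.cos z‖ ^ 2 = Real.cos z.re ^ 2 + Real.sinh z.im ^ 2 := by
    rw [Complex.sq_norm, Complex.cos_eq, Complex.normSq_apply]
    have e : Complex.cos z.re * Complex.cosh z.im - Complex.sin z.re * Complex.sinh z.im * Complex.I
      = ⟨Real.cos z.re * Real.cosh z.im, - (Real.sin z.re * Real.sinh z.im)⟩ := by
      rw [← Complex.ofReal_cos, ← Complex.ofReal_cosh, ← Complex.ofReal_sin, ← Complex.ofReal_sinh]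
      apply Complex.ext <;>
        simp [-Complex.ofReal_cos, -Complex.ofReal_cosh, -Complex.ofReal_sin, -Complex.ofReal_sinh]
    rw [e]
    have := Real.sin_sq_add_cos_sq z.re
    have h2 := Real.cosh_sq z.im
    have h3 : Real.sin z.re ^ 2 = 1 - Real.cos z.re ^ 2 := by linarith
    simp only
    calc _ = Real.cos z.re ^ 2 * Real.cosh z.im ^ 2 + Real.sin z.re ^ 2 * Real.sinh z.im ^ 2 := by
          ring
      _ = _ := by rw [h2, h3]; ring
  have h2 : |z.im| ≤ |Real.sinh z.im| := by
    rcases le_total 0 z.im with h | h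
    · exact abs_le_abs_of_nonneg h (Real.self_le_sinh_iff.2 h)
    · exact abs_le_abs_of_nonpos h (Real.sinh_le_self_iff.2 h)
  have h3 : Real.sinh z.im ^ 2 ≤ ‖Complex.cos z‖ ^ 2 := by
    have := sq_nonneg (Real.cos z.re)
    linarith
  exact h2.trans (abs_le_of_sq_le_sq h3 (norm_nonneg _))

lemma bp_cos {f : ℂ → ℂ} {c : ℂ} {R : ℝ} (hR : 0 < R)
    (hd : DifferentiableOn ℂ f (ball c R)) (h1 : ∀ z ∈ ball c R, f z ≠ 1)
    (h2 : ∀ z ∈ ball c R, f z ≠ -1) :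
    ∃ g : ℂ → ℂ, DifferentiableOn ℂ g (ball c R) ∧ (∀ z ∈ ball c R, Complex.cos (g z) = f z) ∧
      ‖g c‖ ≤ 4 + ‖f c‖ := by
  obtain ⟨l, hl, hle⟩ := bp_log hR (f := fun z => f z ^ 2 - 1) ((hd.pow 2).sub_const 1) (by
    intro z hz e
    have : (f z - 1) * (f z - -1) = 0 := by linear_combination e
    rcases mul_eq_zero.1 this with h | h
    · exact h1 z hz (sub_eq_zero.1 h)
    · exact h2 z hz (sub_eq_zero.1 h))
  set s : ℂ → ℂ := fun z => Complex.exp (l z / 2) with hs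
  have hsd : DifferentiableOn ℂ s (ball c R) := (hl.div_const 2).cexp
  have hs2 : ∀ z ∈ ball c R, (f z + s z) * (f z - s z) = 1 := by
    intro z hz
    have : s z ^ 2 = f z ^ 2 - 1 := by
      rw [← hle z hz, hs, ← Complex.exp_nat_mul]; congr 1; push_cast; ring
    linear_combination -this
  obtain ⟨g, hg, hge⟩ := bp_log hR (f := fun z => f z + s z) (hd.add hsd) (by
    intro z hz e
    have := hs2 z hz
    rw [e] at this
    simp at this)
  have hcb : c ∈ ball c R := mem_ball_self hR
  set k : ℤ := round ((g c / Complex.I).re / (2 * Real.pi)) with hk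
  have hcos : ∀ z ∈ ball c R, Complex.cos (g z / Complex.I - k * (2 * Real.pi)) = f z := by
    intro z hz
    rw [Complex.cos_sub_int_mul_two_pi, Complex.cos, neg_mul,
      div_mul_cancel₀ _ Complex.I_ne_zero, Complex.exp_neg, hge z hz,
      inv_eq_of_mul_eq_one_right (hs2 z hz)]
    ring
  refine ⟨fun z => g z / Complex.I - k * (2 * Real.pi), (hg.div_const _).sub_const _, hcos, ?_⟩
  have him := bp_abs_im (g c / Complex.I - k * (2 * Real.pi))
  rw [hcos c hcb] at him
  have hre : |(g c / Complex.I - k * (2 * Real.pi)).re| ≤ 4 := by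
    have e : (g c / Complex.I - k * (2 * Real.pi)).re = (g c / Complex.I).re - k * (2 * Real.pi) := by
      rw [Complex.sub_re]
      congr 1
      have : ((k : ℂ) * (2 * Real.pi)) = ((k * (2 * Real.pi) : ℝ) : ℂ) := by push_cast; ring
      rw [this, Complex.ofReal_re]
    rw [e]
    have h := abs_sub_round ((g c / Complex.I).re / (2 * Real.pi))
    rw [← hk] at h
    have hp := Real.pi_pos
    have e2 : (g c / Complex.I).re - k * (2 * Real.pi) =
      ((g c / Complex.I).re / (2 * Real.pi) - k) * (2 * Real.pi) := by field_simp
    rw [e2, abs_mul, abs_of_pos (by positivity : 0 < 2 * Real.pi)]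
    have := Real.pi_le_four
    nlinarith
  exact (Complex.norm_le_abs_re_add_abs_im _).trans (add_le_add hre him)

lemma bp_dense (p : ℂ) : ∃ q ∈ ball p 4, ∃ m : ℤ, Complex.cos q = m := by
  have hy : ∀ y : ℝ, 0 ≤ y → ∃ y', |y' - y| ≤ 2 ∧ ∃ m : ℤ, Real.cosh y' = m := by
    intro y hy
    have hc : Real.cosh y + 1 ≤ Real.cosh (y + 2) := by
      rw [Real.cosh_add]
      have a1 := Real.one_le_cosh y
      have a2 : 2 ≤ Real.sinh 2 := Real.self_le_sinh_iff.2 (by norm_num)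
      have a3 : (0:ℝ) ≤ Real.sinh y := Real.sinh_nonneg_iff.2 hy
      have a4 : 2 ≤ Real.cosh 2 := a2.trans (Real.sinh_lt_cosh 2).le
      nlinarith
    have := intermediate_value_Icc (show y ≤ y + 2 by linarith) Real.continuous_cosh.continuousOn
    obtain ⟨y', hy', e⟩ := this (show ((⌈Real.cosh y⌉ : ℤ) : ℝ) ∈ _ from
      ⟨Int.le_ceil _, (Int.ceil_lt_add_one _).le.trans hc⟩)
    exact ⟨y', by rw [abs_le]; constructor <;> linarith [hy'.1, hy'.2], _, e⟩
  have hy2 : ∃ y', |y' - p.im| ≤ 2 ∧ ∃ m : ℤ, Real.cosh y' = m := by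
    rcases le_total 0 p.im with h | h
    · exact hy _ h
    · obtain ⟨y', h1, m, h2⟩ := hy (-p.im) (by linarith)
      refine ⟨-y', ?_, m, by rwa [Real.cosh_neg]⟩
      rw [← abs_neg]; convert h1 using 2; ring
  obtain ⟨y, h1, m, h2⟩ := hy2
  set k : ℤ := round (p.re / Real.pi) with hk
  have hx : |(k * Real.pi : ℝ) - p.re| < 2 := by
    have h := abs_sub_round (p.re / Real.pi)
    rw [← hk] at h
    have hp := Real.pi_pos
    have e2 : p.re - k * Real.pi = (p.re / Real.pi - k) * Real.pi := by field_simp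
    rw [abs_sub_comm, e2, abs_mul, abs_of_pos hp]
    have := Real.pi_lt_four
    nlinarith
  refine ⟨⟨k * Real.pi, y⟩, ?_, ((-1 : ℤˣ) ^ k : ℤˣ) * m, ?_⟩
  · rw [mem_ball, dist_eq_norm]
    refine (Complex.norm_le_abs_re_add_abs_im _).trans_lt ?_
    simp only [Complex.sub_re, Complex.sub_im]
    linarith
  · rw [Complex.cos_eq]
    simp only
    rw [← Complex.ofReal_cos, ← Complex.ofReal_cosh, ← Complex.ofReal_sin, Real.cos_int_mul_pi,
      Real.sin_int_mul_pi, h2]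
    rcases Int.even_or_odd k with hk | hk
    · simp [hk.neg_one_zpow]
    · simp [hk.neg_one_zpow]

lemma bp_norm_cos (z : ℂ) : ‖Complex.cos z‖ ≤ Real.exp ‖z‖ := by
  rw [Complex.cos, norm_div]
  have h1 := Complex.norm_exp_le_exp_norm (z * Complex.I)
  have h2 := Complex.norm_exp_le_exp_norm (-z * Complex.I)
  have h3 := norm_add_le (Complex.exp (z * Complex.I)) (Complex.exp (-z * Complex.I))
  simp only [norm_mul, norm_neg, Complex.norm_I, mul_one] at h1 h2
  rw [Complex.norm_ofNat]
  linarith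

lemma bp_schottky (M : ℝ) : ∃ C : ℝ, ∀ (f : ℂ → ℂ) (c : ℂ), DifferentiableOn ℂ f (ball c 8) →
    (∀ z ∈ ball c 8, f z ≠ 1) → (∀ z ∈ ball c 8, f z ≠ -1) → ‖f c‖ ≤ M →
    ∀ z ∈ ball c 4, ‖f z‖ ≤ C := by
  refine ⟨Real.exp (4 * Real.exp (520 + M + 512)), fun f c hd h1 h2 hM => ?_⟩
  have hp0 : (Real.pi : ℂ) ≠ 0 := Complex.ofReal_ne_zero.2 Real.pi_ne_zero
  have hp3 := Real.pi_gt_three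
  have hp4 := Real.pi_le_four
  obtain ⟨g, hg, hgf, hgc⟩ := bp_cos (by norm_num) hd h1 h2
  have hgi : ∀ z ∈ ball c 8, ∀ m : ℤ, g z / Real.pi ≠ m := by
    intro z hz m e
    have e1 : g z = m * Real.pi := by rw [← e]; field_simp
    have e2 := hgf z hz
    have e3 : (m * Real.pi : ℂ) = ((m * Real.pi : ℝ) : ℂ) := by push_cast; ring
    rw [e1, e3, ← Complex.ofReal_cos, Real.cos_int_mul_pi] at e2
    rcases Int.even_or_odd m with hk | hk
    · apply h1 z hz; rw [← e2]; simp [hk.neg_one_zpow]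
    · apply h2 z hz; rw [← e2]; simp [hk.neg_one_zpow]
  obtain ⟨h, hh, hhg, hhc⟩ := bp_cos (f := fun z => g z / Real.pi) (by norm_num) (hg.div_const _)
    (fun z hz => by simpa using hgi z hz 1) (fun z hz => by simpa using hgi z hz (-1))
  have hder : ∀ z ∈ ball c 4, ‖deriv h z‖ ≤ 128 := by
    intro z hz
    have hsub : ball z 4 ⊆ ball c 8 := by
      apply ball_subset_ball'
      rw [mem_ball] at hz
      linarith
    have := bp_bloch (c := z) (R := 4) (by norm_num) (hh.mono hsub) (by
      intro p
      obtain ⟨q, hq, m, hm⟩ := bp_dense p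
      refine ⟨q, hq, ?_⟩
      rintro ⟨w, hw, rfl⟩
      rw [hhg w (hsub hw)] at hm
      exact hgi w (hsub hw) m hm)
    linarith
  intro z hz
  have hsub : ball c 4 ⊆ ball c 8 := ball_subset_ball (by norm_num)
  have hmv := (convex_ball c 4).norm_image_sub_le_of_norm_hasDerivWithin_le (C := 128)
    (fun w hw => (hh.differentiableAt
      (isOpen_ball.mem_nhds (hsub hw))).hasDerivAt.hasDerivWithinAt) hder
      (mem_ball_self (by norm_num)) hz
  have hz4 : ‖z - c‖ ≤ 4 := by rw [mem_ball, dist_eq_norm] at hz; exact hz.le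
  have hgp : ‖g c / (Real.pi : ℂ)‖ ≤ ‖g c‖ := by
    rw [norm_div, Complex.norm_real, Real.norm_of_nonneg Real.pi_pos.le]
    exact div_le_self (norm_nonneg _) (by linarith)
  have hhz : ‖h z‖ ≤ 520 + M + 512 := by
    have := norm_sub_norm_le (h z) (h c)
    linarith
  have hgz : ‖g z‖ ≤ 4 * Real.exp (520 + M + 512) := by
    have e : g z = Complex.cos (h z) * Real.pi := by rw [hhg z (hsub hz)]; field_simp
    rw [e, norm_mul, Complex.norm_real, Real.norm_of_nonneg Real.pi_pos.le, mul_comm]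
    gcongr
    exact (bp_norm_cos _).trans (Real.exp_le_exp.2 hhz)
  rw [← hgf z (hsub hz)]
  exact (bp_norm_cos _).trans (Real.exp_le_exp.2 hgz)


/-- Big Picard Theorem: a holomorphic function on the punctured unit disk with
an essential singularity at `0` (neither removable nor a pole) omits at most
one complex value. -/
theorem big_picard (f : ℂ → ℂ)
    (hf : DifferentiableOn ℂ f (Metric.ball (0 : ℂ) 1 \ {0}))
    (hnotremovable : ¬∃ F : ℂ → ℂ, DifferentiableOn ℂ F (Metric.ball (0 : ℂ) 1) ∧
      ∀ z ∈ Metric.ball (0 : ℂ) 1 \ {0}, F z = f z)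
    (hnotpole : ¬Filter.Tendsto (fun z => ‖f z‖)
      (nhdsWithin 0 (Metric.ball (0 : ℂ) 1 \ {0})) Filter.atTop) :
    ∀ a b : ℂ, (∀ z ∈ Metric.ball (0 : ℂ) 1 \ {0}, f z ≠ a) →
      (∀ z ∈ Metric.ball (0 : ℂ) 1 \ {0}, f z ≠ b) → a = b := by
  intro a b ha hb
  by_contra hab
  have hba : b - a ≠ 0 := sub_ne_zero.2 (Ne.symm hab)
  set F : ℂ → ℂ := fun z => (2 * f z - a - b) / (b - a) with hF
  have hFd : DifferentiableOn ℂ F (ball (0 : ℂ) 1 \ {0}) :=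
    (((hf.const_mul 2).sub_const a).sub_const b).div_const _
  have hF1 : ∀ z ∈ ball (0 : ℂ) 1 \ {0}, F z ≠ 1 := by
    intro z hz e
    apply hb z hz
    rw [hF] at e
    simp only at e
    rw [div_eq_one_iff_eq hba] at e
    linear_combination e / 2
  have hF2 : ∀ z ∈ ball (0 : ℂ) 1 \ {0}, F z ≠ -1 := by
    intro z hz e
    apply ha z hz
    rw [hF] at e
    simp only at e
    rw [div_eq_iff hba] at e
    linear_combination e / 2
  have hM : ∃ M, ∀ r > 0, ∃ z ∈ ball (0 : ℂ) 1 \ {0}, ‖z‖ < r ∧ ‖F z‖ ≤ M := by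
    rw [Filter.tendsto_atTop] at hnotpole
    push Not at hnotpole
    obtain ⟨M, hM⟩ := hnotpole
    refine ⟨(2 * M + ‖a‖ + ‖b‖) / ‖b - a‖, fun r hr => ?_⟩
    have h1 : ∀ᶠ z in 𝓝[ball (0 : ℂ) 1 \ {0}] 0, z ∈ ball (0 : ℂ) 1 \ {0} ∧ ‖z‖ < r := by
      refine (eventually_mem_nhdsWithin).and (nhdsWithin_le_nhds ?_)
      filter_upwards [ball_mem_nhds (0 : ℂ) hr] with z hz
      simpa using hz
    obtain ⟨z, hz, hz1, hz2⟩ := (hM.and_eventually h1).exists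
    refine ⟨z, hz1, hz2, ?_⟩
    rw [hF]
    simp only
    rw [norm_div]
    gcongr
    have e1 := norm_sub_le (2 * f z - a) b
    have e2 := norm_sub_le (2 * f z) a
    rw [norm_mul, Complex.norm_ofNat] at e2
    linarith
  obtain ⟨M, hM⟩ := hM
  obtain ⟨C, hC⟩ := bp_schottky M
  have hexp8 : Real.exp (-8) < 1 := by rw [Real.exp_lt_one_iff]; norm_num
  have circle : ∀ z0 : ℂ, z0 ≠ 0 → ‖z0‖ < Real.exp (-8) → ‖F z0‖ ≤ M →
      ∀ z : ℂ, ‖z‖ = ‖z0‖ → ‖F z‖ ≤ C := by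
    intro z0 h0 h8 hz0 z hz
    have hre : (Complex.log z0).re < -8 := by
      rw [Complex.log_re]
      exact (Real.log_lt_iff_lt_exp (norm_pos_iff.2 h0)).2 h8
    have hmaps : MapsTo Complex.exp (ball (Complex.log z0) 8) (ball (0 : ℂ) 1 \ {0}) := by
      intro w hw
      refine ⟨?_, Complex.exp_ne_zero w⟩
      rw [mem_ball_zero_iff, Complex.norm_exp, Real.exp_lt_one_iff]
      rw [mem_ball, dist_eq_norm] at hw
      have := Complex.re_le_norm (w - Complex.log z0)
      rw [Complex.sub_re] at this
      linarith
    have key := hC (fun w => F (Complex.exp w)) (Complex.log z0)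
      (hFd.comp Complex.differentiable_exp.differentiableOn hmaps)
      (fun w hw => hF1 _ (hmaps hw)) (fun w hw => hF2 _ (hmaps hw))
      (by rw [Complex.exp_log h0]; exact hz0)
    have hq : z / z0 ≠ 0 := by
      apply div_ne_zero _ h0
      rw [← norm_pos_iff, hz]; exact norm_pos_iff.2 h0
    have hlog : ‖Complex.log (z / z0)‖ < 4 := by
      refine (Complex.norm_le_abs_re_add_abs_im _).trans_lt ?_
      rw [Complex.log_re, norm_div, hz, div_self (norm_ne_zero_iff.2 h0), Real.log_one, abs_zero,
        zero_add, Complex.log_im]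
      exact (Complex.abs_arg_le_pi _).trans_lt Real.pi_lt_four
    have := key (Complex.log z0 + Complex.log (z / z0)) (by simpa [mem_ball, dist_eq_norm] using hlog)
    simp only [Complex.exp_add, Complex.exp_log h0, Complex.exp_log hq] at this
    rwa [mul_div_cancel₀ _ h0] at this
  obtain ⟨z0, hz0, hz0r, hz0M⟩ := hM (Real.exp (-8)) (Real.exp_pos _)
  have hz0ne : z0 ≠ 0 := hz0.2
  have hbound : ∀ z : ℂ, z ≠ 0 → ‖z‖ < ‖z0‖ → ‖F z‖ ≤ C := by
    intro z hz hzz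
    obtain ⟨z1, hz1, hz1r, hz1M⟩ := hM ‖z‖ (norm_pos_iff.2 hz)
    have hz1ne : z1 ≠ 0 := hz1.2
    have hU : IsOpen (ball (0 : ℂ) ‖z0‖ \ closedBall 0 ‖z1‖) := isOpen_ball.sdiff isClosed_closedBall
    have hcl : closure (ball (0 : ℂ) ‖z0‖ \ closedBall 0 ‖z1‖) ⊆
        closedBall 0 ‖z0‖ \ ball 0 ‖z1‖ := by
      apply closure_minimal
      · exact sdiff_subset_sdiff ball_subset_closedBall ball_subset_closedBall
      · exact isClosed_closedBall.sdiff isOpen_ball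
    have hin : closedBall (0 : ℂ) ‖z0‖ \ ball 0 ‖z1‖ ⊆ ball (0 : ℂ) 1 \ {0} := by
      rintro w ⟨hw1, hw2⟩
      refine ⟨?_, ?_⟩
      · rw [mem_closedBall_zero_iff] at hw1
        rw [mem_ball_zero_iff]
        linarith
      · rintro rfl
        exact hw2 (mem_ball_self (norm_pos_iff.2 hz1ne))
    refine Complex.norm_le_of_forall_mem_frontier_norm_le
      (U := ball (0 : ℂ) ‖z0‖ \ closedBall 0 ‖z1‖) (isBounded_ball.subset sdiff_subset)
      (hFd.mono (hcl.trans hin)).diffContOnCl (fun w hw => ?_) (subset_closure ⟨?_, ?_⟩)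
    · rw [hU.frontier_eq] at hw
      have h1 := hcl hw.1
      have h2 := hw.2
      simp only [Set.mem_sdiff, mem_closedBall_zero_iff, mem_ball_zero_iff, not_and, not_not, not_lt]
        at h1 h2
      rcases h1.1.lt_or_eq with h | h
      · exact circle z1 hz1ne (by linarith) hz1M w (le_antisymm (h2 h) h1.2)
      · exact circle z0 hz0ne hz0r hz0M w h
    · simpa using hzz
    · simpa using hz1r
  apply hnotremovable
  have ho : (fun z => F z - F 0) =o[𝓝[≠] 0] fun z => (z - 0)⁻¹ := by
    apply IsBoundedUnder.isLittleO_sub_self_inv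
    refine ⟨C + ‖F 0‖, eventually_map.2 ?_⟩
    filter_upwards [self_mem_nhdsWithin,
      nhdsWithin_le_nhds (ball_mem_nhds (0 : ℂ) (norm_pos_iff.2 hz0ne))] with z hz hz'
    have h1 := hbound z hz (by simpa using hz')
    have h2 := norm_sub_le (F z) (F 0)
    simp only [Function.comp]
    linarith
  have hG := Complex.differentiableOn_update_limUnder_of_isLittleO
    (ball_mem_nhds (0 : ℂ) one_pos) hFd ho
  refine ⟨fun z => ((b - a) * Function.update F 0 (limUnder (𝓝[≠] 0) F) z + a + b) / 2,
    (((hG.const_mul _).add_const _).add_const _).div_const _, fun z hz => ?_⟩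
  have hz0 : z ≠ 0 := hz.2
  simp only [Function.update_of_ne hz0, hF]
  field_simp
  ring
end
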